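/- If x ∈ 𝒳 is a slowly oscillating periodic solution of Wright's equation x'(t) = -α(e^{x(t-1)} - 1) for a parameter α ∈ [π/2, 2.07], then q̄(x) < 3. -/

import Mathlib

open Real Set Filter

noncomputable section

/-- `x` solves Wright's equation `x'(t) = -α (e^{x(t-1)} - 1)` on all of `ℝ`. -/
def WrightSol (α : ℝ) (x : ℝ → ℝ) : Prop :=
  ∀ t : ℝ, HasDerivAt x (-α * (Real.exp (x (t - 1)) - 1)) t

/-- The space 𝒳: C¹ functions with `x 0 = 0`, `x' 0 > 0` and `x < 0` on `(-1,0)`. -/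
def InX (x : ℝ → ℝ) : Prop :=
  ContDiff ℝ 1 x ∧ x 0 = 0 ∧ 0 < deriv x 0 ∧ ∀ t ∈ Set.Ioo (-1 : ℝ) 0, x t < 0

/-- A slowly oscillating periodic solution in 𝒳, with first zero `q` and data `qbar`:
positive on `(0,q)`, negative on `(q, q+qbar)`, periodic with minimal period `q+qbar`. -/
def SOPSX (α q qbar : ℝ) (x : ℝ → ℝ) : Prop :=
  InX x ∧ WrightSol α x ∧ 1 < q ∧ 1 < qbar ∧
  (∀ t ∈ Set.Ioo 0 q, 0 < x t) ∧
  (∀ t ∈ Set.Ioo q (q + qbar), x t < 0) ∧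
  Function.Periodic x (q + qbar) ∧
  (∀ T : ℝ, 0 < T → Function.Periodic x T → q + qbar ≤ T)

/-- A slowly oscillating periodic solution (up to time translation). -/
def SOPS (α : ℝ) (x : ℝ → ℝ) : Prop :=
  WrightSol α x ∧
  ∃ q qbar : ℝ, 1 < q ∧ 1 < qbar ∧
    (∃ τ : ℝ, (∀ t ∈ Set.Ioo 0 q, 0 < x (t + τ)) ∧
      (∀ t ∈ Set.Ioo q (q + qbar), x (t + τ) < 0)) ∧
    Function.Periodic x (q + qbar) ∧
    (∀ T : ℝ, 0 < T → Function.Periodic x T → q + qbar ≤ T)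

/-! ### Elementary comparison lemmas -/

theorem wcmp {F G F' G' : ℝ → ℝ} {a b : ℝ} (hab : a ≤ b)
    (hF : ∀ t, HasDerivAt F (F' t) t) (hG : ∀ t, HasDerivAt G (G' t) t)
    (h : ∀ t, a < t → t < b → F' t ≤ G' t) : F b - F a ≤ G b - G a := by
  have hd : ∀ t, HasDerivAt (fun t => G t - F t) (G' t - F' t) t := fun t => (hG t).sub (hF t)
  have hm : MonotoneOn (fun t => G t - F t) (Icc a b) := by
    apply monotoneOn_of_deriv_nonneg (convex_Icc a b)
    · exact fun t _ => (hd t).continuousAt.continuousWithinAt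
    · exact fun t _ => (hd t).differentiableAt.differentiableWithinAt
    · intro t ht
      rw [interior_Icc] at ht
      rw [(hd t).deriv]
      linarith [h t ht.1 ht.2]
  have := hm (left_mem_Icc.2 hab) (right_mem_Icc.2 hab) hab
  simp only at this
  linarith

/-- The facts about the solution which are used. -/
structure WFacts (α q : ℝ) (x : ℝ → ℝ) : Prop where
  hα : 0 < α
  hd : ∀ t : ℝ, HasDerivAt x (-α * (Real.exp (x (t - 1)) - 1)) t
  hq : 1 < q
  x0 : x 0 = 0
  xq : x q = 0
  neg1 : ∀ t, -3 < t → t < 0 → x t < 0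
  pos : ∀ t, 0 < t → t < q → 0 < x t
  neg2 : ∀ t, q < t → t < q + 3 → x t < 0
  end_le : x (q + 3) ≤ 0

theorem wfacts_of {α q qbar : ℝ} {x : ℝ → ℝ} (hα : 0 < α) (hx : SOPSX α q qbar x)
    (h3 : 3 ≤ qbar) : WFacts α q x := by
  obtain ⟨⟨_, h0, _, _⟩, hs, hq, hqb, hp, hn, hper, _⟩ := hx
  have hc : Continuous x := continuous_iff_continuousAt.2 fun t => (hs t).continuousAt
  refine ⟨hα, hs, hq, h0, ?_, ?_, fun t h1 h2 => hp t ⟨h1, h2⟩,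
    fun t h1 h2 => hn t ⟨h1, by linarith⟩, ?_⟩
  · apply le_antisymm
    · have h1 : closure (Ioo q (q + qbar)) ⊆ {t | x t ≤ 0} :=
        closure_minimal (fun t ht => (hn t ht).le) (isClosed_le hc continuous_const)
      rw [closure_Ioo (by linarith)] at h1
      exact h1 ⟨le_rfl, by linarith⟩
    · have h1 : closure (Ioo 0 q) ⊆ {t | 0 ≤ x t} :=
        closure_minimal (fun t ht => (hp t ht).le) (isClosed_le continuous_const hc)
      rw [closure_Ioo (by linarith)] at h1
      exact h1 ⟨by linarith, le_rfl⟩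
  · intro t h1 h2
    rw [← hper t]
    exact hn _ ⟨by linarith, by linarith⟩
  · have h1 : closure (Ioo q (q + qbar)) ⊆ {t | x t ≤ 0} :=
      closure_minimal (fun t ht => (hn t ht).le) (isClosed_le hc continuous_const)
    rw [closure_Ioo (by linarith)] at h1
    exact h1 ⟨by linarith, by linarith⟩

namespace WFacts

variable {α q : ℝ} {x : ℝ → ℝ}

theorem lin_ub (h : WFacts α q x) {a b c : ℝ} (hab : a ≤ b)
    (hc : ∀ t, a < t → t < b → -α * (Real.exp (x (t - 1)) - 1) ≤ c) :
    x b - x a ≤ c * (b - a) := by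
  have := wcmp hab h.hd (G := fun t => c * t) (G' := fun _ => c)
    (fun t => by simpa using (hasDerivAt_id t).const_mul c) hc
  linarith

theorem lin_lb (h : WFacts α q x) {a b c : ℝ} (hab : a ≤ b)
    (hc : ∀ t, a < t → t < b → c ≤ -α * (Real.exp (x (t - 1)) - 1)) :
    c * (b - a) ≤ x b - x a := by
  have := wcmp hab (F := fun t => c * t) (F' := fun _ => c)
    (fun t => by simpa using (hasDerivAt_id t).const_mul c) h.hd hc
  linarith

theorem inc1 (h : WFacts α q x) {s t : ℝ} (hs : -2 ≤ s) (hst : s ≤ t) (ht : t ≤ 1) :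
    x s ≤ x t := by
  have := h.lin_lb (c := 0) hst (fun u h1 h2 => by
    have h3 := h.neg1 (u - 1) (by linarith) (by linarith)
    have h4 : Real.exp (x (u - 1)) ≤ 1 := Real.exp_le_one_iff.2 h3.le
    nlinarith [h.hα])
  linarith

theorem dec (h : WFacts α q x) {s t : ℝ} (hs : 1 ≤ s) (hst : s ≤ t) (ht : t ≤ q + 1) :
    x t ≤ x s := by
  have := h.lin_ub (c := 0) hst (fun u h1 h2 => by
    have h3 := h.pos (u - 1) (by linarith) (by linarith)
    have h4 : 1 ≤ Real.exp (x (u - 1)) := Real.one_le_exp h3.le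
    nlinarith [h.hα])
  linarith

theorem inc2 (h : WFacts α q x) {s t : ℝ} (hs : q + 1 ≤ s) (hst : s ≤ t) (ht : t ≤ q + 4) :
    x s ≤ x t := by
  have := h.lin_lb (c := 0) hst (fun u h1 h2 => by
    have h3 := h.neg2 (u - 1) (by linarith) (by linarith)
    have h4 : Real.exp (x (u - 1)) ≤ 1 := Real.exp_le_one_iff.2 h3.le
    nlinarith [h.hα])
  linarith

theorem nonneg (h : WFacts α q x) {t : ℝ} (h0 : 0 ≤ t) (h1 : t ≤ q) : 0 ≤ x t := by
  rcases h0.eq_or_lt with rfl | h0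
  · rw [h.x0]
  rcases h1.eq_or_lt with rfl | h1
  · rw [h.xq]
  exact (h.pos t h0 h1).le

/-- The lower bound on `[-1,0]`. -/
theorem p2 (h : WFacts α q x) {A κ s : ℝ} (hA : α ≤ A) (hκ : κ ≤ Real.exp (x (-1)))
    (hs : -1 ≤ s) (hs0 : s ≤ 0) : A * s + κ * (1 - Real.exp (A * s)) ≤ x s := by
  have hA0 : 0 < A := h.hα.trans_le hA
  have hG : ∀ t : ℝ, HasDerivAt (fun t => A * t - κ * Real.exp (A * t))
      (A - κ * (Real.exp (A * t) * A)) t := by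
    intro t
    have h1 : HasDerivAt (fun t : ℝ => A * t) A t := by
      simpa using (hasDerivAt_id t).const_mul A
    exact h1.sub ((h1.exp).const_mul κ)
  have key := wcmp hs0 h.hd hG (fun t h1 h2 => by
    have hn : x (t - 1) < 0 := h.neg1 _ (by linarith) (by linarith)
    have e1 : Real.exp (x (t - 1)) ≤ 1 := Real.exp_le_one_iff.2 hn.le
    have hl := h.lin_ub (a := t - 1) (b := -1) (c := A) (by linarith) (fun u _ _ => by
      nlinarith [Real.exp_pos (x (u - 1)), h.hα])
    have e2 : Real.exp (x (-1)) * Real.exp (A * t) ≤ Real.exp (x (t - 1)) := by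
      rw [← Real.exp_add]
      exact Real.exp_le_exp.2 (by linarith)
    have e3 := mul_le_mul_of_nonneg_right hκ (Real.exp_pos (A * t)).le
    nlinarith [mul_nonneg (sub_nonneg.2 hA) (sub_nonneg.2 e1),
      mul_le_mul_of_nonneg_left (e3.trans e2) hA0.le])
  simp only [mul_zero, Real.exp_zero, h.x0] at key
  linarith

theorem kappa_le (h : WFacts α q x) {A κ : ℝ} (hA : α ≤ A)
    (hκ : κ ≤ Real.exp (-(A - Real.exp (-A) * (1 - Real.exp (-A))))) :
    κ ≤ Real.exp (x (-1)) := by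
  have h1 := h.p2 hA (Real.exp_pos _).le (s := -1) le_rfl (by norm_num)
  have h2 := h.p2 hA le_rfl (s := -1) le_rfl (by norm_num)
  have hA0 : 0 < A := h.hα.trans_le hA
  have e0 : Real.exp (-A) ≤ 1 := Real.exp_le_one_iff.2 (by linarith)
  rw [mul_neg_one] at h1 h2
  have h3 : Real.exp (-A) ≤ Real.exp (x (-1)) := Real.exp_le_exp.2 (by linarith)
  refine hκ.trans (Real.exp_le_exp.2 ?_)
  nlinarith

end WFacts

/-- The comparison function. -/
def wH (A κ τ : ℝ) : ℝ :=
  A * τ - (1 - Real.exp (-(A * τ))) - κ * (1 - Real.exp (-(A * τ))) ^ 2 / 2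

theorem wH_zero (A κ : ℝ) : wH A κ 0 = 0 := by simp [wH]

theorem wH_deriv (A κ s : ℝ) : HasDerivAt (fun s => -wH A κ (1 - s))
    (A * (1 - Real.exp (-(A * (1 - s))) * (1 + κ * (1 - Real.exp (-(A * (1 - s))))))) s := by
  have h1 : HasDerivAt (fun s : ℝ => -(A * (1 - s))) A s := by
    have := (((hasDerivAt_id' s).const_sub 1).const_mul A).fun_neg
    exact this.congr_deriv (by ring)
  have h2 := h1.exp
  have h3 := h2.const_sub 1
  have h4 := ((h1.fun_neg.fun_sub h3).fun_sub (((h3.fun_pow 2).const_mul κ).div_const 2)).fun_neg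
  unfold wH
  simp only [neg_neg] at h4
  exact h4.congr_deriv (by simp; ring)

namespace WFacts

variable {α q : ℝ} {x : ℝ → ℝ}

theorem p3 (h : WFacts α q x) {A κ s t : ℝ} (hA : α ≤ A) (hκ : κ ≤ Real.exp (x (-1)))
    (hs : 0 ≤ s) (hst : s ≤ t) (ht : t ≤ 1) :
    x t - x s ≤ wH A κ (1 - s) - wH A κ (1 - t) := by
  have hA0 : 0 < A := h.hα.trans_le hA
  have key := wcmp hst h.hd (wH_deriv A κ) (fun u h1 h2 => by
    have hn : x (u - 1) < 0 := h.neg1 _ (by linarith) (by linarith)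
    have e1 : Real.exp (x (u - 1)) ≤ 1 := Real.exp_le_one_iff.2 hn.le
    have hp := h.p2 hA hκ (s := u - 1) (by linarith) (by linarith)
    have e0 : A * (u - 1) = -(A * (1 - u)) := by ring
    rw [e0] at hp
    set E := Real.exp (-(A * (1 - u))) with hE
    have e2 : E * (1 + κ * (1 - E)) ≤ Real.exp (x (u - 1)) := by
      calc E * (1 + κ * (1 - E)) ≤ E * Real.exp (κ * (1 - E)) :=
            mul_le_mul_of_nonneg_left (by linarith [Real.add_one_le_exp (κ * (1 - E))])
              (Real.exp_pos _).le
        _ = Real.exp (-(A * (1 - u)) + κ * (1 - E)) := by rw [Real.exp_add]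
        _ ≤ _ := Real.exp_le_exp.2 hp
    nlinarith [mul_nonneg (sub_nonneg.2 hA) (sub_nonneg.2 e1),
      mul_le_mul_of_nonneg_left e2 hA0.le])
  linarith

theorem p4 (h : WFacts α q x) : α - 1 ≤ x 1 := by
  have hα := h.hα
  set ρ := α * (1 - Real.exp (x (-1))) with hρ
  have hn1 : x (-1) < 0 := h.neg1 _ (by norm_num) (by norm_num)
  have hρ0 : 0 < ρ := mul_pos hα (by linarith [Real.exp_lt_one_iff.2 hn1])
  have h1 : ∀ s, -1 ≤ s → s ≤ 0 → x s ≤ ρ * s := by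
    intro s hs hs0
    have := h.lin_lb (c := ρ) hs0 (fun t h1 h2 => by
      have : x (t - 1) ≤ x (-1) := h.inc1 (by linarith) (by linarith) (by norm_num)
      have := Real.exp_le_exp.2 this
      rw [hρ]
      nlinarith)
    rw [h.x0] at this
    linarith
  have hF : ∀ t : ℝ, HasDerivAt (fun t => α * (t - Real.exp (ρ * (t - 1)) / ρ))
      (α * (1 - Real.exp (ρ * (t - 1)))) t := by
    intro t
    have h2 : HasDerivAt (fun t : ℝ => ρ * (t - 1)) ρ t := by
      simpa using ((hasDerivAt_id t).sub_const 1).const_mul ρ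
    have h3 := ((hasDerivAt_id' t).fun_sub (h2.exp.div_const ρ)).const_mul α
    exact h3.congr_deriv (by field_simp)
  have key := wcmp zero_le_one hF h.hd (fun t h2 h3 => by
    have := Real.exp_le_exp.2 (h1 (t - 1) (by linarith) (by linarith))
    nlinarith)
  have ha := Real.exp_le_exp.2 (h1 (-1) le_rfl (by norm_num))
  simp only [h.x0, sub_self, mul_zero, Real.exp_zero, zero_sub] at key
  have h5 := h1 (-1) le_rfl (by norm_num)
  have h6 : Real.exp (x (-1)) ≤ Real.exp (ρ * -1) := ha
  have h7 : α * (1 - Real.exp (ρ * -1)) / ρ ≤ 1 := by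
    rw [div_le_one hρ0]
    nlinarith
  have h8 : α * (1 - 1 / ρ) - α * (-(Real.exp (ρ * -1) / ρ))
      = α - α * (1 - Real.exp (ρ * -1)) / ρ := by
    field_simp
    ring
  linarith

/-- Bound on `[q, q+1]`. -/
theorem p6 (h : WFacts α q x) {c τ : ℝ} (hq2 : q ≤ 2)
    (hc1 : c ≤ α * (Real.exp (x (q - 1)) - 1)) (hc2 : c ≤ -x (q + 1))
    (h0 : 0 ≤ τ) (h1 : τ ≤ 1) : x (q + τ) ≤ -c * τ := by
  have hα := h.hα
  have hq := h.hq
  rcases le_or_gt (x (q - 1)) (x (q - 1 + τ)) with hh | hh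
  · have := h.lin_ub (a := q) (b := q + τ) (c := -c) (by linarith) (fun t h2 h3 => by
      have h4 : x (q - 1) ≤ x (t - 1) := by
        rcases le_or_gt (t - 1) 1 with h5 | h5
        · exact h.inc1 (by linarith) (by linarith) h5
        · exact hh.trans (h.dec h5.le (by linarith) (by linarith))
      have := Real.exp_le_exp.2 h4
      nlinarith)
    rw [h.xq] at this
    linarith
  · have hp : 1 < q - 1 + τ := by
      by_contra hp
      exact absurd (h.inc1 (s := q - 1) (t := q - 1 + τ) (by linarith) (by linarith)
        (not_lt.1 hp)) (not_le.2 hh)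
    set g := α * (Real.exp (x (q - 1 + τ)) - 1) with hg
    have a1 := h.lin_ub (a := q) (b := q + τ) (c := -g) (by linarith) (fun t h2 h3 => by
      have h4 : x (q - 1 + τ) ≤ x (t - 1) := by
        rcases le_or_gt (t - 1) 1 with h5 | h5
        · exact hh.le.trans (h.inc1 (by linarith) (by linarith) h5)
        · exact h.dec h5.le (by linarith) (by linarith)
      have := Real.exp_le_exp.2 h4
      nlinarith)
    have a2 := h.lin_lb (a := q + τ) (b := q + 1) (c := -g) (by linarith) (fun t h2 h3 => by
      have h4 : x (t - 1) ≤ x (q - 1 + τ) := h.dec hp.le (by linarith) (by linarith)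
      have := Real.exp_le_exp.2 h4
      nlinarith)
    rw [h.xq] at a1
    have b1 := mul_le_mul_of_nonneg_left a1 (sub_nonneg.2 h1)
    have b2 := mul_le_mul_of_nonneg_left a2 h0
    have b3 := mul_le_mul_of_nonneg_left hc2 h0
    nlinarith

/-- Convexity of `exp` in the form used below. -/
theorem _root_.wexp_conv {l y : ℝ} (h0 : 0 ≤ l) (h1 : l ≤ 1) :
    Real.exp (-(l * y)) ≤ 1 - l + l * Real.exp (-y) := by
  have := convexOn_exp.2 (mem_univ (0 : ℝ)) (mem_univ (-y)) (sub_nonneg.2 h1) h0 (by ring)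
  simp only [smul_eq_mul, mul_zero, zero_add, Real.exp_zero, mul_one] at this
  rwa [mul_neg] at this

theorem p7 (h : WFacts α q x) {α0 l C D : ℝ} (hq2 : q ≤ 2) (hα0 : α0 ≤ α)
    (h0 : 0 ≤ l) (h1 : l ≤ 1) (hC : 0 < C)
    (hc1 : l * C ≤ α * (Real.exp (x (q - 1)) - 1)) (hc2 : l * C ≤ -x (q + 1))
    (hα00 : 0 < α0)
    (hD : D * C ≤ α0 * (C - (1 - Real.exp (-C)))) :
    l * D ≤ x (q + 2) - x (q + 1) := by
  have hF : ∀ t : ℝ, HasDerivAt (fun t => α0 * l * (t + Real.exp (-(C * (t - (q + 1)))) / C))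
      (α0 * l * (1 - Real.exp (-(C * (t - (q + 1)))))) t := by
    intro t
    have h2 : HasDerivAt (fun t : ℝ => -(C * (t - (q + 1)))) (-C) t := by
      exact (((hasDerivAt_id' t).sub_const (q + 1)).const_mul C).fun_neg.congr_deriv (by ring)
    have h3 := ((hasDerivAt_id' t).fun_add (h2.exp.div_const C)).const_mul (α0 * l)
    exact h3.congr_deriv (by field_simp; ring)
  have key := wcmp (a := q + 1) (b := q + 2) (by linarith) hF h.hd (fun t h2 h3 => by
    have h4 := h.p6 hq2 hc1 hc2 (τ := t - (q + 1)) (by linarith) (by linarith)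
    have h5 : q + (t - (q + 1)) = t - 1 := by ring
    rw [h5] at h4
    have h6 := Real.exp_le_exp.2 h4
    have h7 := wexp_conv (y := C * (t - (q + 1))) h0 h1
    have h8 : -(l * C) * (t - (q + 1)) = -(l * (C * (t - (q + 1)))) := by ring
    rw [h8] at h6
    have h9 : Real.exp (-(C * (t - (q + 1)))) ≤ 1 :=
      Real.exp_le_one_iff.2 (by nlinarith)
    have h10 : 0 ≤ l * (1 - Real.exp (-(C * (t - (q + 1))))) := mul_nonneg h0 (by linarith)
    nlinarith [mul_le_mul_of_nonneg_right hα0 h10, h.hα])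
  have e1 : q + 2 - (q + 1) = 1 := by ring
  simp only [e1, sub_self, mul_zero, neg_zero, Real.exp_zero, mul_one] at key
  have h9 : D ≤ α0 * (1 - (1 - Real.exp (-C)) / C) := by
    have : α0 * (1 - (1 - Real.exp (-C)) / C) = α0 * (C - (1 - Real.exp (-C))) / C := by
      field_simp
    rw [this, le_div_iff₀ hC]
    exact hD
  have h10 := mul_le_mul_of_nonneg_left h9 h0
  have h11 : α0 * l * (q + 2 + Real.exp (-C) / C) - α0 * l * (q + 1 + 1 / C)
      = l * (α0 * (1 - (1 - Real.exp (-C)) / C)) := by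
    field_simp
    ring
  linarith

/-- The case of small `m`. -/
theorem p8 (h : WFacts α q x) {α0 C D : ℝ} (hq2 : q ≤ 2) (hα0 : α0 ≤ α)
    (hα00 : 0 < α0) (hC : 0 < C) (hm : -x (q + 1) < C)
    (hc1 : C ≤ α * (Real.exp (x (q - 1)) - 1))
    (hD : D * C ≤ α0 * (C - (1 - Real.exp (-C)))) (hDC : D < C)
    (hc : C - D < α0 * (1 - Real.exp (-(C - D)))) : False := by
  have hq := h.hq
  have hm0 : 0 < -x (q + 1) := by
    have := h.neg2 (q + 1) (by linarith) (by linarith)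
    linarith
  have hb0 : 0 < -x (q + 2) := by
    have := h.neg2 (q + 2) (by linarith) (by linarith)
    linarith
  set l := -x (q + 1) / C with hl
  have hl0 : 0 < l := div_pos hm0 hC
  have hl1 : l ≤ 1 := (div_le_one hC).2 hm.le
  have hlC : l * C = -x (q + 1) := div_mul_cancel₀ _ hC.ne'
  have k1 := h.p7 hq2 hα0 hl0.le hl1 hC (by rw [hlC]; linarith) hlC.le hα00 hD
  set β := C - D with hβ
  have hβ0 : 0 < β := sub_pos.2 hDC
  have hb : -x (q + 2) ≤ l * β := by
    rw [hβ]
    nlinarith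
  have hbβ : -x (q + 2) ≤ β := by nlinarith
  have k2 := h.lin_lb (a := q + 2) (b := q + 3) (c := α * (1 - Real.exp (x (q + 2))))
    (by linarith) (fun t h2 h3 => by
      have := Real.exp_le_exp.2 (h.inc2 (s := t - 1) (t := q + 2) (by linarith) (by linarith)
        (by linarith))
      nlinarith [h.hα])
  have k3 := h.end_le
  have k4 := wexp_conv (l := -x (q + 2) / β) (y := β) (by positivity) ((div_le_one hβ0).2 hbβ)
  rw [div_mul_cancel₀ _ hβ0.ne', neg_neg] at k4
  set θ := -x (q + 2) / β with hθ
  have hθ0 : 0 < θ := div_pos hb0 hβ0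
  have hθβ : θ * β = -x (q + 2) := div_mul_cancel₀ _ hβ0.ne'
  have hE : 0 ≤ 1 - Real.exp (-β) := by
    have := Real.exp_lt_one_iff.2 (neg_lt_zero.2 hβ0)
    linarith
  have k5 : β < α * (1 - Real.exp (-β)) := hc.trans_le (mul_le_mul_of_nonneg_right hα0 hE)
  have k6 := mul_lt_mul_of_pos_left k5 hθ0
  have k7 : α * (θ * (1 - Real.exp (-β))) ≤ α * (1 - Real.exp (x (q + 2))) :=
    mul_le_mul_of_nonneg_left (by linarith) h.hα.le
  nlinarith

/-- The case of large `m`. -/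
theorem p9 (h : WFacts α q x) {α0 C D mh : ℝ} (hq2 : q ≤ 2) (hα0 : α0 ≤ α)
    (hα00 : 0 < α0) (hC : 0 < C) (hm : C ≤ -x (q + 1))
    (hc1 : C ≤ α * (Real.exp (x (q - 1)) - 1))
    (hD : D * C ≤ α0 * (C - (1 - Real.exp (-C)))) (hD0 : 0 < D)
    (hmh : -x (q + 1) ≤ mh) (hDm : D < mh)
    (hc : (mh - D) * D < α0 * (D - Real.exp (-(mh - D)) * (1 - Real.exp (-D)))) : False := by
  have hq := h.hq
  have hα := h.hα
  have hb0 : 0 < -x (q + 2) := by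
    have := h.neg2 (q + 2) (by linarith) (by linarith)
    linarith
  have k1 := h.p7 (l := 1) hq2 hα0 zero_le_one le_rfl hC (by linarith) (by linarith) hα00 hD
  rw [one_mul] at k1
  -- convexity
  have cv : ∀ t, q + 1 ≤ t → t ≤ q + 2 → x t ≤ x (q + 2) - D * (q + 2 - t) := by
    intro t h1 h2
    set σ := -α * (Real.exp (x (t - 1)) - 1) with hσ
    have a1 := h.lin_ub (a := q + 1) (b := t) (c := σ) h1 (fun u h3 h4 => by
      have := Real.exp_le_exp.2 (h.dec (s := u - 1) (t := t - 1) (by linarith) (by linarith)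
        (by linarith))
      nlinarith)
    have a2 := h.lin_lb (a := t) (b := q + 2) (c := σ) h2 (fun u h3 h4 => by
      have := Real.exp_le_exp.2 (h.dec (s := t - 1) (t := u - 1) (by linarith) (by linarith)
        (by linarith))
      nlinarith)
    have b1 := mul_le_mul_of_nonneg_left a1 (sub_nonneg.2 h2)
    have b2 := mul_le_mul_of_nonneg_left a2 (sub_nonneg.2 h1)
    have b3 := mul_le_mul_of_nonneg_left k1 (sub_nonneg.2 h2)
    nlinarith
  set b := -x (q + 2) with hb
  have hF : ∀ t : ℝ, HasDerivAt
      (fun t => α * (t - Real.exp (-b) * (Real.exp (-(D * (q + 3 - t))) / D)))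
      (α * (1 - Real.exp (-b) * Real.exp (-(D * (q + 3 - t))))) t := by
    intro t
    have h2 : HasDerivAt (fun t : ℝ => -(D * (q + 3 - t))) D t := by
      exact (((hasDerivAt_id' t).const_sub (q + 3)).const_mul D).fun_neg.congr_deriv (by ring)
    have h3 := ((hasDerivAt_id' t).fun_sub ((h2.exp.div_const D).const_mul (Real.exp (-b)))).const_mul α
    exact h3.congr_deriv (by field_simp)
  have key := wcmp (a := q + 2) (b := q + 3) (by linarith) hF h.hd (fun t h2 h3 => by
    have h4 := cv (t - 1) (by linarith) (by linarith)
    rw [← Real.exp_add]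
    have h5 := Real.exp_le_exp.2 (h4.trans (show _ ≤ -b + -(D * (q + 3 - t)) by
      rw [hb]; linarith))
    nlinarith)
  have e1 : q + 3 - (q + 2) = 1 := by ring
  simp only [e1, sub_self, mul_zero, neg_zero, Real.exp_zero, mul_one] at key
  have k3 := h.end_le
  set ψ := (1 - Real.exp (-D)) / D with hψ
  have hψD : ψ * D = 1 - Real.exp (-D) := div_mul_cancel₀ _ hD0.ne'
  have hψ1 : ψ ≤ 1 := by
    rw [hψ, div_le_one hD0]
    linarith [Real.add_one_le_exp (-D)]
  have hψ0 : 0 < ψ := div_pos (by linarith [Real.exp_lt_one_iff.2 (neg_lt_zero.2 hD0)]) hD0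
  have k4 : α * (1 - Real.exp (-b) * ψ) ≤ b := by
    have : α * (q + 3 - Real.exp (-b) * (1 / D)) - α * (q + 2 - Real.exp (-b) * (Real.exp (-D) / D))
        = α * (1 - Real.exp (-b) * ψ) := by
      rw [hψ]; field_simp; ring
    linarith
  set B := mh - D with hB
  have hB0 : 0 < B := sub_pos.2 hDm
  have hbB : b ≤ B := by linarith
  have k5 := wexp_conv (l := b / B) (y := B) (by positivity) ((div_le_one hB0).2 hbB)
  rw [div_mul_cancel₀ _ hB0.ne'] at k5
  set θ := b / B with hθ
  have hθ0 : 0 < θ := div_pos hb0 hB0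
  have hθ1 : θ ≤ 1 := (div_le_one hB0).2 hbB
  have hθB : θ * B = b := div_mul_cancel₀ _ hB0.ne'
  have k6 : B < α0 * (1 - Real.exp (-B) * ψ) := by
    rw [← hψD] at hc
    have : α0 * (D - Real.exp (-B) * (ψ * D)) = α0 * (1 - Real.exp (-B) * ψ) * D := by ring
    rw [this] at hc
    exact lt_of_mul_lt_mul_right hc hD0.le
  have k7 : 0 < 1 - Real.exp (-B) * ψ := by
    by_contra hh
    nlinarith
  have k8 : B < α * (1 - Real.exp (-B) * ψ) := k6.trans_le (mul_le_mul_of_nonneg_right hα0 k7.le)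
  have k9 := mul_lt_mul_of_pos_left k8 hθ0
  have k10 : θ * (1 - Real.exp (-B) * ψ) ≤ 1 - Real.exp (-b) * ψ := by
    have := mul_le_mul_of_nonneg_right k5 hψ0.le
    nlinarith [mul_nonneg (sub_nonneg.2 hθ1) (sub_nonneg.2 hψ1)]
  have k11 := mul_le_mul_of_nonneg_left k10 hα.le
  nlinarith

end WFacts
/-! ### Fixed point arithmetic -/

/-- Forces evaluation of a natural number before it is handed on. -/
def wfrc (n : ℕ) (k : ℕ → ℕ) : ℕ := Nat.rec (k 0) (fun m _ => k (m + 1)) n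

/-- Scale of the fixed point arithmetic. -/
def wS : ℕ := 1000000000

def wsqLo (v : ℕ) : ℕ := v * v / wS
def wsqHi (v : ℕ) : ℕ := v * v / wS + 1

/-- Lower bound for the exponential. -/
def wexpLo (y : ℕ) : ℕ :=
  wfrc (y / 64) fun u => wfrc (wS + u + u * u / (2 * wS) + u * u * u / (6 * wS * wS)) fun v =>
  wfrc (wsqLo v) fun v => wfrc (wsqLo v) fun v => wfrc (wsqLo v) fun v =>
  wfrc (wsqLo v) fun v => wfrc (wsqLo v) fun v => wsqLo v

/-- Upper bound for the exponential. -/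
def wexpHi (y : ℕ) : ℕ :=
  wfrc (y / 64 + 1) fun u =>
  wfrc (wS + u + (u * u / (2 * wS) + 1) + (u * u * u / (4 * wS * wS) + 1)) fun v =>
  wfrc (wsqHi v) fun v => wfrc (wsqHi v) fun v => wfrc (wsqHi v) fun v =>
  wfrc (wsqHi v) fun v => wfrc (wsqHi v) fun v => wsqHi v

/-- Bounds for `exp (-y)`. -/
def wnegLo (y : ℕ) : ℕ := wS * wS / wexpHi y
def wnegHi (y : ℕ) : ℕ := wS * wS / wexpLo y + 1

/-- Lower bound for `κ`. -/
def wK (A : ℕ) : ℕ := wnegLo (A - wnegLo A * (wS - wnegHi A) / wS)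

def wHhi (a K i : ℕ) : ℕ :=
  wfrc (wS - wnegHi (a * i)) fun d => a * i - (d + K * d * d / (2 * wS * wS))
def wHlo (a K i : ℕ) : ℕ :=
  wfrc (wS - wnegLo (a * i)) fun d => a * i - (d + K * d * d / (2 * wS * wS) + 1)

/-- Bounds for `exp (x (j/64)) - 1`. -/
def wfl (a K M0 j : ℕ) : ℕ := wexpLo (M0 - wHhi a K (64 - j)) - wS
def wfu (a K M1 j : ℕ) : ℕ :=
  wfrc (wHhi a K 64 - wHlo a K (64 - j)) fun y => wexpHi (M1 - (M1 - y)) - wS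

def wW (a K M1 n : ℕ) : ℕ :=
  Nat.rec 0 (fun j w => w + (a * wfu a K M1 (j + 1) / wS + 1)) n

/-- The main loop; the state is `j`, `z`, `t`. -/
def wL (a K M0 n : ℕ) : ℕ → ℕ → ℕ → ℕ :=
  Nat.rec (fun _ z t => Nat.rec t (fun _ _ => wS * wS) z)
    (fun _ ih j z t => wfrc j fun j => wfrc z fun z => wfrc t fun t =>
      ih (j + 1) (z - a * wfl a K M0 j / wS) (t + (a * (wexpHi z - wS) / wS + 1))) n

/-- The check for one box of parameters. -/
def wchk (a0 a K M0 M1 n j0 C D m : ℕ) : Bool :=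
  Nat.ble K (wK (64 * a)) && (Nat.ble (64 * a) (60 * wS) && (Nat.ble M1 (60 * wS) &&
  (Nat.ble C (60 * wS) && (Nat.ble (m + M0) (60 * wS) &&
  (Nat.ble (n * a) a0 && (Nat.ble j0 64 &&
  (Nat.ble (wW a K M1 j0) M0 && (Nat.ble (wL a K M0 n 0 M1 0 + wW a K M1 64) (m + M0) &&
  (Nat.ble (C * wS) (a0 * wfl a K M0 j0) &&
  (Nat.ble (D * C) (a0 * (C + wnegLo C - wS)) && (Nat.ble (wS + 1) (C + wnegLo C) &&
  (Nat.ble (D + 1) C && (Nat.ble 1 D && (Nat.ble (D + 1) m &&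
  (Nat.ble ((C - D) * wS + a0 * wnegHi (C - D) + 1) (a0 * wS) &&
  Nat.ble ((m - D) * D * wS + a0 * wnegHi (m - D) * (wS - wnegLo D) + 1) (a0 * D * wS))))))))))))))))

/-! ### Soundness of the fixed point arithmetic -/

theorem wfrc_eq (n : ℕ) (k : ℕ → ℕ) : wfrc n k = k n := by
  cases n <;> rfl

theorem wS_cast : ((wS : ℕ) : ℝ) = 1000000000 := by
  norm_num [wS]

theorem wsub_ge (a b : ℕ) : (a : ℝ) - b ≤ ((a - b : ℕ) : ℝ) := by
  have h : a ≤ (a - b) + b := by omega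
  have h' : (a : ℝ) ≤ ((a - b : ℕ) : ℝ) + b := by exact_mod_cast h
  linarith

theorem wsub_le (a b : ℕ) {r : ℝ} (h0 : 0 ≤ r) (h : (a : ℝ) - b ≤ r) :
    ((a - b : ℕ) : ℝ) ≤ r := by
  rcases le_total a b with hab | hab
  · rw [Nat.sub_eq_zero_of_le hab]
    simpa using h0
  · rw [Nat.cast_sub hab]
    exact h

theorem wdiv_ge (a b : ℕ) (hb : 0 < b) : (a : ℝ) / b ≤ ((a / b : ℕ) : ℝ) + 1 := by
  rw [div_le_iff₀ (by exact_mod_cast hb)]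
  have h := Nat.lt_div_mul_add (a := a) hb
  have h' : a ≤ (a / b + 1) * b := by
    rw [add_mul, one_mul]
    exact h.le
  exact_mod_cast h'

theorem wsqLo_le {v : ℕ} {e : ℝ} (h : (v : ℝ) ≤ 1000000000 * e) :
    (wsqLo v : ℝ) ≤ 1000000000 * e ^ 2 := by
  unfold wsqLo
  refine (Nat.cast_div_le).trans ?_
  rw [wS_cast, div_le_iff₀ (by norm_num)]
  push_cast
  have h0 : (0 : ℝ) ≤ v := Nat.cast_nonneg v
  nlinarith [mul_le_mul h h h0 (h0.trans h)]

theorem wsqHi_ge {v : ℕ} {e : ℝ} (he : 0 ≤ e) (h : 1000000000 * e ≤ (v : ℝ)) :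
    1000000000 * e ^ 2 ≤ (wsqHi v : ℝ) := by
  unfold wsqHi
  push_cast
  refine le_trans ?_ (wdiv_ge _ _ (by norm_num [wS]))
  rw [wS_cast, le_div_iff₀ (by norm_num)]
  push_cast
  have h0 : (0 : ℝ) ≤ 1000000000 * e := by positivity
  nlinarith [mul_le_mul h h h0 (h0.trans h)]

theorem wexp_pow (y : ℝ) : Real.exp (y / 1000000000) =
    ((((((Real.exp (y / 64 / 1000000000)) ^ 2) ^ 2) ^ 2) ^ 2) ^ 2) ^ 2 := by
  simp only [← pow_mul]
  rw [← Real.exp_nat_mul]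
  congr 1
  norm_num
  ring

theorem wexpLo_le (y : ℕ) : (wexpLo y : ℝ) ≤ 1000000000 * Real.exp (y / 1000000000) := by
  unfold wexpLo
  simp only [wfrc_eq]
  rw [wexp_pow]
  refine wsqLo_le (wsqLo_le (wsqLo_le (wsqLo_le (wsqLo_le (wsqLo_le ?_)))))
  have hu : ((y / 64 : ℕ) : ℝ) ≤ y / 64 := by
    have := Nat.cast_div_le (α := ℝ) (m := y) (n := 64)
    simpa using this
  generalize (y / 64 : ℕ) = u at *
  have hu' : (u : ℝ) / 1000000000 ≤ (y : ℝ) / 64 / 1000000000 := by linarith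
  refine le_trans ?_ (mul_le_mul_of_nonneg_left (Real.exp_le_exp.2 hu') (by norm_num))
  have h1 : ((u * u / (2 * wS) : ℕ) : ℝ) ≤ u * u / (2 * 1000000000) := by
    have := Nat.cast_div_le (α := ℝ) (m := u * u) (n := 2 * wS)
    push_cast at this
    rwa [wS_cast] at this
  have h2 : ((u * u * u / (6 * wS * wS) : ℕ) : ℝ) ≤
      u * u * u / (6 * 1000000000 * 1000000000) := by
    have := Nat.cast_div_le (α := ℝ) (m := u * u * u) (n := 6 * wS * wS)
    push_cast at this
    rwa [wS_cast] at this
  have h3 := Real.sum_le_exp_of_nonneg (x := (u : ℝ) / 1000000000) (by positivity) 4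
  simp only [Finset.sum_range_succ, Finset.sum_range_zero, Nat.factorial] at h3
  push_cast [wS_cast]
  norm_num at h3
  have h4 : (u : ℝ) * u / (2 * 1000000000) = 1000000000 * ((u / 1000000000) ^ 2 / 2) := by
    ring
  have h5 : (u : ℝ) * u * u / (6 * 1000000000 * 1000000000)
      = 1000000000 * ((u / 1000000000) ^ 3 / 6) := by
    ring
  linarith

theorem wexp_ub {v : ℝ} (h0 : 0 ≤ v) (h1 : v ≤ 1) :
    Real.exp v ≤ 1 + v + v ^ 2 / 2 + v ^ 3 / 4 := by
  have h := Real.exp_bound' h0 h1 (n := 3) (by norm_num)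
  simp only [Finset.sum_range_succ, Finset.sum_range_zero, Nat.factorial] at h
  norm_num at h
  have : 0 ≤ v ^ 3 := by positivity
  linarith

theorem wexpHi_ge {y : ℕ} (hy : y ≤ 60 * wS) :
    1000000000 * Real.exp (y / 1000000000) ≤ (wexpHi y : ℝ) := by
  unfold wexpHi
  simp only [wfrc_eq]
  rw [wexp_pow]
  have e0 := (Real.exp_pos ((y : ℝ) / 64 / 1000000000)).le
  refine wsqHi_ge (by positivity) (wsqHi_ge (by positivity) (wsqHi_ge (by positivity)
    (wsqHi_ge (by positivity) (wsqHi_ge (by positivity) (wsqHi_ge (by positivity) ?_)))))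
  have hu : (y : ℝ) / 64 ≤ ((y / 64 + 1 : ℕ) : ℝ) := by
    have := wdiv_ge y 64 (by norm_num)
    push_cast at this ⊢
    exact this
  have hb : y / 64 + 1 ≤ wS := by
    unfold wS at *
    omega
  generalize (y / 64 + 1 : ℕ) = u at *
  have hu' : (y : ℝ) / 64 / 1000000000 ≤ (u : ℝ) / 1000000000 := by linarith
  refine (mul_le_mul_of_nonneg_left (Real.exp_le_exp.2 hu') (by norm_num)).trans ?_
  have hb' : (u : ℝ) ≤ 1000000000 := by
    rw [← wS_cast]
    exact_mod_cast hb
  have h1 := wdiv_ge (u * u) (2 * wS) (by norm_num [wS])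
  have h2 := wdiv_ge (u * u * u) (4 * wS * wS) (by norm_num [wS])
  have h3 := wexp_ub (v := (u : ℝ) / 1000000000) (by positivity)
    ((div_le_one (by norm_num)).2 hb')
  push_cast [wS_cast] at h1 h2 ⊢
  have h4 : (u : ℝ) * u / (2 * 1000000000) = 1000000000 * ((u / 1000000000) ^ 2 / 2) := by
    ring
  have h5 : (u : ℝ) * u * u / (4 * 1000000000 * 1000000000)
      = 1000000000 * ((u / 1000000000) ^ 3 / 4) := by
    ring
  linarith

theorem wexpLo_pos (y : ℕ) : wS ≤ wexpLo y := by
  have hsq : ∀ v, wS ≤ v → wS ≤ wsqLo v := by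
    intro v hv
    unfold wsqLo
    rw [Nat.le_div_iff_mul_le (by norm_num [wS])]
    exact Nat.mul_le_mul hv hv
  unfold wexpLo
  simp only [wfrc_eq]
  refine hsq _ (hsq _ (hsq _ (hsq _ (hsq _ (hsq _ ?_)))))
  generalize y / 64 = u
  generalize u * u / (2 * wS) = v
  generalize u * u * u / (6 * wS * wS) = w
  omega

theorem wnegLo_le {y : ℕ} (hy : y ≤ 60 * wS) :
    (wnegLo y : ℝ) ≤ 1000000000 * Real.exp (-(y / 1000000000)) := by
  unfold wnegLo
  refine (Nat.cast_div_le).trans ?_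
  have h := wexpHi_ge hy
  have e := Real.exp_pos ((y : ℝ) / 1000000000)
  have h0 : (0 : ℝ) < wexpHi y := lt_of_lt_of_le (by positivity) h
  rw [div_le_iff₀ h0]
  push_cast [wS_cast]
  have e1 : Real.exp (-((y : ℝ) / 1000000000)) * Real.exp (y / 1000000000) = 1 := by
    rw [← Real.exp_add]
    simp
  have := mul_le_mul_of_nonneg_left h (Real.exp_pos (-((y : ℝ) / 1000000000))).le
  nlinarith

theorem wnegHi_ge (y : ℕ) : 1000000000 * Real.exp (-(y / 1000000000)) ≤ (wnegHi y : ℝ) := by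
  unfold wnegHi
  have hp : 0 < wexpLo y := lt_of_lt_of_le (by norm_num [wS]) (wexpLo_pos y)
  push_cast
  refine le_trans ?_ (wdiv_ge _ _ hp)
  have h := wexpLo_le y
  have h0 : (0 : ℝ) < wexpLo y := by exact_mod_cast hp
  rw [le_div_iff₀ h0]
  push_cast [wS_cast]
  have e1 : Real.exp (-((y : ℝ) / 1000000000)) * Real.exp (y / 1000000000) = 1 := by
    rw [← Real.exp_add]
    simp
  have := mul_le_mul_of_nonneg_left h (Real.exp_pos (-((y : ℝ) / 1000000000))).le
  nlinarith

theorem wK_le {A : ℕ} (hA : A ≤ 60 * wS) :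
    (wK A : ℝ) / 1000000000 ≤ Real.exp (-((A : ℝ) / 1000000000 -
      Real.exp (-(A / 1000000000)) * (1 - Real.exp (-(A / 1000000000))))) := by
  unfold wK
  set E := Real.exp (-((A : ℝ) / 1000000000)) with hE
  have hE1 : E ≤ 1 := Real.exp_le_one_iff.2 (by
    have : (0 : ℝ) ≤ (A : ℝ) / 1000000000 := by positivity
    linarith)
  have hE0 : 0 < E := Real.exp_pos _
  have h1 := wnegLo_le hA
  have h2 := wnegHi_ge A
  have h3 : ((wS - wnegHi A : ℕ) : ℝ) ≤ 1000000000 * (1 - E) :=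
    wsub_le _ _ (by linarith) (by rw [wS_cast]; linarith)
  have h4 : ((wnegLo A * (wS - wnegHi A) / wS : ℕ) : ℝ) ≤ 1000000000 * (E * (1 - E)) := by
    refine (Nat.cast_div_le).trans ?_
    rw [wS_cast, div_le_iff₀ (by norm_num)]
    push_cast
    have := mul_le_mul h1 h3 (Nat.cast_nonneg _) (by positivity)
    linarith
  have h5 := wsub_ge A (wnegLo A * (wS - wnegHi A) / wS)
  have h6 := wnegLo_le (y := A - wnegLo A * (wS - wnegHi A) / wS) ((Nat.sub_le _ _).trans hA)
  rw [div_le_iff₀ (by norm_num), mul_comm (Real.exp _)]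
  refine h6.trans (mul_le_mul_of_nonneg_left (Real.exp_le_exp.2 ?_) (by norm_num))
  rw [neg_le_neg_iff, le_div_iff₀ (by norm_num)]
  linarith

theorem wHhi_ge (a K i : ℕ) {A κ : ℝ} (hA : A = 64 * a / 1000000000)
    (hκ : κ = K / 1000000000) :
    1000000000 * wH A κ (i / 64) ≤ (wHhi a K i : ℝ) := by
  unfold wHhi
  simp only [wfrc_eq]
  have hκ0 : 0 ≤ κ := by rw [hκ]; positivity
  refine le_trans ?_ (wsub_ge _ _)
  have hAi : A * (i / 64) = (a * i : ℕ) / 1000000000 := by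
    rw [hA]; push_cast; ring
  unfold wH
  rw [hAi]
  set E := Real.exp (-(((a * i : ℕ) : ℝ) / 1000000000)) with hE
  have hE1 : E ≤ 1 := Real.exp_le_one_iff.2 (by
    have : (0 : ℝ) ≤ ((a * i : ℕ) : ℝ) / 1000000000 := by positivity
    linarith)
  have h2 := wnegHi_ge (a * i)
  have h3 : ((wS - wnegHi (a * i) : ℕ) : ℝ) ≤ 1000000000 * (1 - E) :=
    wsub_le _ _ (by linarith) (by rw [wS_cast]; linarith)
  generalize wS - wnegHi (a * i) = d at *
  have h4 : ((K * d * d / (2 * wS * wS) : ℕ) : ℝ) ≤ 1000000000 * (κ * (1 - E) ^ 2 / 2) := by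
    refine (Nat.cast_div_le).trans ?_
    push_cast [wS_cast]
    rw [div_le_iff₀ (by norm_num)]
    have hd := mul_le_mul h3 h3 (Nat.cast_nonneg _) (by linarith)
    have hK : (K : ℝ) = 1000000000 * κ := by rw [hκ]; ring
    rw [hK]
    nlinarith [mul_le_mul_of_nonneg_left hd hκ0]
  push_cast at h4 ⊢
  linarith

theorem wHlo_le (a K i : ℕ) {A κ : ℝ} (hai : a * i ≤ 60 * wS) (hA : A = 64 * a / 1000000000)
    (hκ : κ = K / 1000000000) :
    (wHlo a K i : ℝ) ≤ max 0 (1000000000 * wH A κ (i / 64)) := by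
  unfold wHlo
  simp only [wfrc_eq]
  have hκ0 : 0 ≤ κ := by rw [hκ]; positivity
  refine wsub_le _ _ (le_max_left _ _) (le_trans ?_ (le_max_right _ _))
  have hAi : A * (i / 64) = (a * i : ℕ) / 1000000000 := by
    rw [hA]; push_cast; ring
  unfold wH
  rw [hAi]
  set E := Real.exp (-(((a * i : ℕ) : ℝ) / 1000000000)) with hE
  have hE1 : E ≤ 1 := Real.exp_le_one_iff.2 (by
    have : (0 : ℝ) ≤ ((a * i : ℕ) : ℝ) / 1000000000 := by positivity
    linarith)
  have h2 := wnegLo_le hai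
  have h3 : 1000000000 * (1 - E) ≤ ((wS - wnegLo (a * i) : ℕ) : ℝ) := by
    refine le_trans ?_ (wsub_ge _ _)
    rw [wS_cast]; linarith
  generalize wS - wnegLo (a * i) = d at *
  have h4 : 1000000000 * (κ * (1 - E) ^ 2 / 2) ≤ ((K * d * d / (2 * wS * wS) : ℕ) : ℝ) + 1 := by
    refine le_trans ?_ (wdiv_ge _ _ (by norm_num [wS]))
    push_cast [wS_cast]
    rw [le_div_iff₀ (by norm_num)]
    have hd := mul_le_mul h3 h3 (by linarith) (Nat.cast_nonneg _)
    have hK : (K : ℝ) = 1000000000 * κ := by rw [hκ]; ring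
    rw [hK]
    nlinarith [mul_le_mul_of_nonneg_left hd hκ0]
  push_cast at h4 ⊢
  linarith

theorem wL_zero_zero (a K M0 j t : ℕ) : wL a K M0 0 j 0 t = t := rfl

theorem wL_zero_succ (a K M0 j z t : ℕ) : wL a K M0 0 j (z + 1) t = wS * wS := rfl

theorem wL_succ (a K M0 n j z t : ℕ) : wL a K M0 (n + 1) j z t =
    wL a K M0 n (j + 1) (z - a * wfl a K M0 j / wS)
      (t + (a * (wexpHi z - wS) / wS + 1)) := by
  have : wL a K M0 (n + 1) j z t = wfrc j fun j => wfrc z fun z => wfrc t fun t =>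
    wL a K M0 n (j + 1) (z - a * wfl a K M0 j / wS)
      (t + (a * (wexpHi z - wS) / wS + 1)) := rfl
  rw [this, wfrc_eq, wfrc_eq, wfrc_eq]

/-! ### The rigorous integration on the grid -/

/-- The data of a box. -/
structure WBox (α q : ℝ) (x : ℝ → ℝ) (a0 a K M0 M1 : ℕ) : Prop extends WFacts α q x where
  hα0 : (a0 : ℝ) ≤ 1000000000 * α
  hαA : 1000000000 * α ≤ 64 * a
  hK : K ≤ wK (64 * a)
  ha : 64 * a ≤ 60 * wS
  hM0 : (M0 : ℝ) ≤ 1000000000 * x 1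
  hM1 : 1000000000 * x 1 ≤ M1
  hM : M1 ≤ 60 * wS

theorem wkappa {α q : ℝ} {x : ℝ → ℝ} {a K : ℕ} (h : WFacts α q x)
    (hαA : 1000000000 * α ≤ 64 * a) (hK : K ≤ wK (64 * a)) (ha : 64 * a ≤ 60 * wS) :
    (K : ℝ) / 1000000000 ≤ Real.exp (x (-1)) := by
  apply h.kappa_le (A := 64 * a / 1000000000) (by linarith)
  have h1 := wK_le ha
  have h2 : (K : ℝ) ≤ wK (64 * a) := by exact_mod_cast hK
  push_cast at h1
  linarith

/-- The upper bound for `x 1`. -/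
theorem wM_le {α q : ℝ} {x : ℝ → ℝ} {a K : ℕ} (h : WFacts α q x)
    (hαA : 1000000000 * α ≤ 64 * a) (hK : K ≤ wK (64 * a)) (ha : 64 * a ≤ 60 * wS) :
    1000000000 * x 1 ≤ wHhi a K 64 := by
  have h1 := h.p3 (A := 64 * a / 1000000000) (by linarith) (wkappa h hαA hK ha)
    le_rfl zero_le_one le_rfl
  have h2 := wHhi_ge a K 64 (A := 64 * a / 1000000000) rfl rfl
  norm_num [wH_zero, h.x0] at h1 h2
  linarith

namespace WBox

variable {α q : ℝ} {x : ℝ → ℝ} {a0 a K M0 M1 : ℕ}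

theorem fl_le (h : WBox α q x a0 a K M0 M1) {j : ℕ} (hj : j ≤ 64) :
    (wfl a K M0 j : ℝ) ≤ 1000000000 * (Real.exp (x (j / 64)) - 1) := by
  have hq := h.hq
  have hj' : (j : ℝ) ≤ 64 := by exact_mod_cast hj
  have hj0 : (0 : ℝ) ≤ j := Nat.cast_nonneg j
  have hx0 : 0 ≤ x (j / 64) := h.nonneg (by positivity) (by linarith)
  have h1 := h.p3 (A := 64 * a / 1000000000) (by linarith [h.hαA])
    (wkappa h.toWFacts h.hαA h.hK h.ha) (s := j / 64) (t := 1) (by positivity) (by linarith) le_rfl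
  have h2 := wHhi_ge a K (64 - j) (A := 64 * a / 1000000000) rfl rfl
  have h3 : ((64 - j : ℕ) : ℝ) / 64 = 1 - j / 64 := by
    rw [Nat.cast_sub hj]; push_cast; ring
  rw [h3] at h2
  rw [sub_self, wH_zero] at h1
  unfold wfl
  have h4 : ((M0 - wHhi a K (64 - j) : ℕ) : ℝ) ≤ 1000000000 * x (j / 64) :=
    wsub_le _ _ (by linarith) (by linarith [h.hM0])
  have h5 := wexpLo_le (M0 - wHhi a K (64 - j))
  have h6 : Real.exp (((M0 - wHhi a K (64 - j) : ℕ) : ℝ) / 1000000000) ≤ Real.exp (x (j / 64)) :=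
    Real.exp_le_exp.2 (by linarith)
  exact wsub_le _ _ (by linarith [Real.one_le_exp hx0]) (by rw [wS_cast]; linarith)

theorem fu_ge (h : WBox α q x a0 a K M0 M1) {j : ℕ} (hj : j ≤ 64) :
    1000000000 * (Real.exp (x (j / 64)) - 1) ≤ wfu a K M1 j := by
  have hq := h.hq
  have hj' : (j : ℝ) ≤ 64 := by exact_mod_cast hj
  have hj0 : (0 : ℝ) ≤ j := Nat.cast_nonneg j
  have hx1 : x (j / 64) ≤ x 1 := h.inc1 (by linarith) (by linarith) le_rfl
  have h1 := h.p3 (A := 64 * a / 1000000000) (by linarith [h.hαA])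
    (wkappa h.toWFacts h.hαA h.hK h.ha) (s := 0) (t := j / 64) le_rfl (by positivity) (by linarith)
  have h2 := wHlo_le a K (64 - j) (A := 64 * a / 1000000000) (κ := K / 1000000000)
    (le_trans (by rw [mul_comm]; exact Nat.mul_le_mul_right _ (Nat.sub_le _ _)) h.ha) rfl rfl
  have h3 : ((64 - j : ℕ) : ℝ) / 64 = 1 - j / 64 := by
    rw [Nat.cast_sub hj]; push_cast; ring
  rw [h3] at h2
  have h4 := wHhi_ge a K 64 (A := 64 * a / 1000000000) (κ := K / 1000000000) rfl rfl
  have h4' := wM_le h.toWFacts h.hαA h.hK h.ha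
  rw [h.x0, sub_zero] at h1
  norm_num at h4
  unfold wfu
  rw [wfrc_eq]
  set y := wHhi a K 64 - wHlo a K (64 - j) with hy
  have h5 : 1000000000 * x (j / 64) ≤ y := by
    refine le_trans ?_ (wsub_ge _ _)
    rcases max_cases (0 : ℝ) (1000000000 * wH (64 * a / 1000000000) (K / 1000000000) (1 - j / 64))
      with ⟨h6, _⟩ | ⟨h6, _⟩
    · rw [h6] at h2
      linarith
    · rw [h6] at h2
      linarith
  have h6 : M1 - (M1 - y) = min M1 y := by omega
  rw [h6]
  have h7 : 1000000000 * x (j / 64) ≤ (min M1 y : ℕ) := by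
    rw [Nat.cast_min]
    exact le_min (by linarith [h.hM1]) h5
  have h8 := wexpHi_ge (y := min M1 y) ((min_le_left _ _).trans h.hM)
  refine le_trans ?_ (wsub_ge _ _)
  have h9 : Real.exp (x (j / 64)) ≤ Real.exp (((min M1 y : ℕ) : ℝ) / 1000000000) :=
    Real.exp_le_exp.2 (by linarith)
  rw [wS_cast]
  linarith

theorem W_ge (h : WBox α q x a0 a K M0 M1) {j : ℕ} (hj : j ≤ 64) :
    1000000000 * x 1 - wW a K M1 j ≤ 1000000000 * x (1 + j / 64) := by
  induction j with
  | zero => simp [wW]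
  | succ j ih =>
    have ih := ih (by omega)
    have hW : wW a K M1 (j + 1) = wW a K M1 j + (a * wfu a K M1 (j + 1) / wS + 1) := rfl
    rw [hW]
    have hj' : (j : ℝ) + 1 ≤ 64 := by exact_mod_cast hj
    have hj0 : (0 : ℝ) ≤ j := Nat.cast_nonneg j
    have hf := h.fu_ge hj
    have hdv := wdiv_ge (a * wfu a K M1 (j + 1)) wS (by norm_num [wS])
    rw [wS_cast] at hdv
    set F := wfu a K M1 (j + 1)
    have hF0 : (0 : ℝ) ≤ F := Nat.cast_nonneg F
    have key := h.lin_lb (a := 1 + j / 64) (b := 1 + (j + 1 : ℕ) / 64)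
      (c := -α * (F / 1000000000)) (by push_cast; linarith) (fun t h1 h2 => by
        push_cast at h2 hf
        have h3 := Real.exp_le_exp.2 (h.inc1 (s := t - 1) (t := (j + 1) / 64) (by linarith)
          (by linarith) (by linarith))
        nlinarith [h.hα])
    push_cast at key hdv ⊢
    have e1 : 1 + ((j : ℝ) + 1) / 64 - (1 + j / 64) = 1 / 64 := by ring
    rw [e1] at key
    have := mul_le_mul_of_nonneg_right h.hαA hF0
    linarith

/-- Soundness of the main loop. -/
theorem L_sound (h : WBox α q x a0 a K M0 M1) {B : ℕ} (hB : B ≤ 60 * wS) (n : ℕ) :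
    ∀ j z t : ℕ, z ≤ M1 → ((j + n : ℕ) : ℝ) * a ≤ 1000000000 * α →
      1000000000 * x (1 + j * (a / (1000000000 * α))) ≤ z →
      1000000000 * (x 2 - x (min (1 + j * (a / (1000000000 * α))) q + 1)) ≤ t →
      wL a K M0 n j z t ≤ B →
      q ≤ 2 ∧ 1000000000 * (x 2 - x (q + 1)) ≤ B := by
  have hq := h.hq
  have hα := h.hα
  set k : ℝ := a / (1000000000 * α) with hk
  have hk0 : 0 ≤ k := by positivity
  have hkα : 1000000000 * (α * k) = a := by rw [hk]; field_simp
  have hk64 : 1 / 64 ≤ k := by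
    rw [hk, le_div_iff₀ (by positivity)]
    linarith [h.hαA]
  induction n with
  | zero =>
    intro j z t _ hj hz ht hL
    have hj1 : (j : ℝ) * k ≤ 1 := by
      rw [hk, ← mul_div_assoc, div_le_one (by positivity)]
      simpa using hj
    cases z with
    | zero =>
      rw [wL_zero_zero] at hL
      have hL'' : (t : ℝ) ≤ B := by exact_mod_cast hL
      have hq1 : q ≤ 1 + j * k := by
        by_contra hh
        have := h.pos (1 + j * k) (by positivity) (not_le.1 hh)
        push_cast at hz
        linarith
      rw [min_eq_right hq1] at ht
      exact ⟨by linarith, by linarith⟩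
    | succ z =>
      rw [wL_zero_succ] at hL
      exfalso
      have := hL.trans hB
      norm_num [wS] at this
  | succ n ih =>
    intro j z t hzM hj hz ht hL
    have hL' : wL a K M0 n (j + 1) (z - a * wfl a K M0 j / wS)
        (t + (a * (wexpHi z - wS) / wS + 1)) ≤ B := by
      rwa [wL_succ] at hL
    have hjn : ((j : ℝ) + 1) * k ≤ 1 := by
      rw [hk, ← mul_div_assoc, div_le_one (by positivity)]
      push_cast at hj
      have : (0 : ℝ) ≤ n * a := by positivity
      linarith
    have hj0 : (0 : ℝ) ≤ j := Nat.cast_nonneg j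
    have hjk0 : 0 ≤ (j : ℝ) * k := by positivity
    have hjh : (j : ℝ) / 64 ≤ j * k := by
      have := mul_le_mul_of_nonneg_left hk64 hj0
      linarith
    have hj64 : j ≤ 64 := by
      have : (j : ℝ) ≤ 64 := by linarith
      exact_mod_cast this
    refine ih (j + 1) _ _ ((Nat.sub_le _ _).trans hzM) ?_ ?_ ?_ hL'
    · have e : j + 1 + n = j + (n + 1) := by ring
      rw [e]
      exact hj
    · refine le_trans ?_ (wsub_ge _ _)
      have hf := h.fl_le hj64
      have hdv : ((a * wfl a K M0 j / wS : ℕ) : ℝ) ≤ a * wfl a K M0 j / 1000000000 := by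
        refine (Nat.cast_div_le).trans ?_
        push_cast [wS_cast]
        exact le_rfl
      have key := h.lin_ub (a := 1 + j * k) (b := 1 + (j + 1 : ℕ) * k)
        (c := -α * (wfl a K M0 j / 1000000000)) (by push_cast; linarith) (fun u h1 h2 => by
          push_cast at h2
          have h3 := Real.exp_le_exp.2 (h.inc1 (s := j / 64) (t := u - 1) (by linarith)
            (by linarith) (by linarith))
          nlinarith)
      have e1 : 1 + ((j + 1 : ℕ) : ℝ) * k - (1 + j * k) = k := by push_cast; ring
      rw [e1] at key
      have e2 : 1000000000 * (-α * (wfl a K M0 j / 1000000000) * k)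
        = -(a * wfl a K M0 j / 1000000000) := by
        rw [← hkα]; ring
      linarith
    · have hE := wexpHi_ge (hzM.trans h.hM)
      have hsb := wsub_ge (wexpHi z) wS
      have hdv := wdiv_ge (a * (wexpHi z - wS)) wS (by norm_num [wS])
      rw [wS_cast] at hsb hdv
      push_cast at hdv ⊢
      set G : ℝ := ((wexpHi z - wS : ℕ) : ℝ) with hG
      have hG0 : 0 ≤ G := Nat.cast_nonneg _
      rcases le_or_gt q (1 + j * k) with hc | hc
      · rw [min_eq_right hc] at ht
        rw [min_eq_right (by linarith)]
        have : 0 ≤ (a : ℝ) * G / 1000000000 :=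
          div_nonneg (mul_nonneg (Nat.cast_nonneg a) hG0) (by norm_num)
        linarith
      · rw [min_eq_left hc.le] at ht
        set v := min (1 + ((j : ℝ) + 1) * k) q with hv
        have hv1 : v ≤ 1 + ((j : ℝ) + 1) * k := min_le_left _ _
        have hv2 : v ≤ q := min_le_right _ _
        have hv3 : 1 + (j : ℝ) * k ≤ v := le_min (by linarith) hc.le
        have key := h.lin_lb (a := 1 + j * k + 1) (b := v + 1) (c := -α * (G / 1000000000))
          (by linarith) (fun u h1 h2 => by
            have h3 := Real.exp_le_exp.2 ((h.dec (s := 1 + j * k) (t := u - 1) (by linarith)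
              (by linarith) (by linarith)).trans
              (show x (1 + j * k) ≤ z / 1000000000 by linarith))
            nlinarith)
        have e3 : α * (G / 1000000000) * (v + 1 - (1 + j * k + 1)) ≤ α * (G / 1000000000) * k :=
          mul_le_mul_of_nonneg_left (by linarith)
            (mul_nonneg hα.le (div_nonneg hG0 (by norm_num)))
        have e2 : 1000000000 * (α * (G / 1000000000) * k) = a * G / 1000000000 := by
          rw [← hkα]; ring
        linarith

end WBox

theorem wchk_sound {α q : ℝ} {x : ℝ → ℝ} (h : WFacts α q x) {a0 a K M0 M1 n j0 C D m : ℕ}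
    (hc : wchk a0 a K M0 M1 n j0 C D m = true)
    (hα0 : (a0 : ℝ) ≤ 1000000000 * α) (hαA : 1000000000 * α ≤ 64 * a)
    (hM0 : (M0 : ℝ) ≤ 1000000000 * x 1) (hM1 : 1000000000 * x 1 ≤ M1) : False := by
  simp only [wchk, Bool.and_eq_true, Nat.ble_eq] at hc
  obtain ⟨c1, c2, c3, c4, c5, c6, c7, c8, c9, c10, c11, c12, c13, c14, c15, c16, c17⟩ := hc
  have hq := h.hq
  have hα := h.hα
  have hb : WBox α q x a0 a K M0 M1 := ⟨h, hα0, hαA, c1, c2, hM0, hM1, c3⟩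
  have hna : ((0 + n : ℕ) : ℝ) * a ≤ 1000000000 * α := by
    rw [zero_add]
    have : ((n : ℝ)) * a ≤ a0 := by exact_mod_cast c6
    linarith
  have hB : wL a K M0 n 0 M1 0 ≤ m + M0 - wW a K M1 64 := by omega
  obtain ⟨hq2, hT⟩ := hb.L_sound (B := m + M0 - wW a K M1 64) (by omega) n 0 M1 0 le_rfl hna
    (by simpa using hM1) (by
      have e : min (1 + ((0 : ℕ) : ℝ) * (a / (1000000000 * α))) q = 1 := by
        simp [hq.le]
      rw [e]
      norm_num) hB
  rw [Nat.cast_sub (by omega)] at hT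
  push_cast at hT
  have hW := hb.W_ge (j := 64) le_rfl
  have hW0 := hb.W_ge c7
  norm_num at hW
  have hm : -x (q + 1) ≤ m / 1000000000 := by linarith
  have hj0' : (j0 : ℝ) ≤ 64 := by exact_mod_cast c7
  have hj00 : (0 : ℝ) ≤ j0 := Nat.cast_nonneg _
  have c8' : (wW a K M1 j0 : ℝ) ≤ M0 := by exact_mod_cast c8
  have hqj : 1 + (j0 : ℝ) / 64 ≤ q := by
    by_contra hh
    have := h.neg2 (1 + (j0 : ℝ) / 64) (not_le.1 hh) (by linarith)
    linarith
  have hfl := hb.fl_le c7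
  have hfq : Real.exp (x (j0 / 64)) ≤ Real.exp (x (q - 1)) :=
    Real.exp_le_exp.2 (h.inc1 (by linarith) (by linarith) (by linarith))
  -- real versions of the remaining checks
  have d10 : (C : ℝ) * 1000000000 ≤ a0 * wfl a K M0 j0 := by
    rw [← wS_cast]; exact_mod_cast c10
  have d12 : (1000000000 : ℝ) < C + wnegLo C := by
    rw [← wS_cast]; exact_mod_cast c12
  have d11 : (D : ℝ) * C ≤ a0 * (C + wnegLo C - 1000000000) := by
    have : (D : ℝ) * C ≤ a0 * ((C + wnegLo C - wS : ℕ) : ℝ) := by exact_mod_cast c11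
    rw [Nat.cast_sub (by omega)] at this
    push_cast [wS_cast] at this
    exact this
  have d13 : (D : ℝ) < C := by exact_mod_cast c13
  have d14 : (0 : ℝ) < D := by exact_mod_cast c14
  have d15 : (D : ℝ) < m := by exact_mod_cast c15
  have d16 : ((C : ℝ) - D) * 1000000000 + a0 * wnegHi (C - D) < a0 * 1000000000 := by
    rw [← wS_cast, ← Nat.cast_sub (by omega)]
    exact_mod_cast Nat.lt_of_lt_of_le (Nat.lt_succ_self _) c16
  have d17 : ((m : ℝ) - D) * D * 1000000000 + a0 * wnegHi (m - D) * ((wS - wnegLo D : ℕ) : ℝ)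
      < a0 * D * 1000000000 := by
    rw [← wS_cast, ← Nat.cast_sub (by omega)]
    exact_mod_cast Nat.lt_of_lt_of_le (Nat.lt_succ_self _) c17
  have n1 := wnegLo_le c4
  have n2 := wnegHi_ge (C - D)
  have n3 := wnegHi_ge (m - D)
  have n4 := wnegLo_le (y := D) (by omega)
  rw [Nat.cast_sub (by omega)] at n2 n3
  have n5 := wsub_ge wS (wnegLo D)
  rw [wS_cast] at n5
  have ha0 : (0 : ℝ) ≤ a0 := Nat.cast_nonneg _
  have ha00 : (0 : ℝ) < a0 := by
    by_contra hh
    have : (a0 : ℝ) = 0 := le_antisymm (not_lt.1 hh) ha0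
    rw [this] at d11
    nlinarith
  have hCR : (C : ℝ) / 1000000000 ≤ α * (Real.exp (x (q - 1)) - 1) := by
    have hfl0 : (0 : ℝ) ≤ wfl a K M0 j0 := Nat.cast_nonneg _
    have : (wfl a K M0 j0 : ℝ) ≤ 1000000000 * (Real.exp (x (q - 1)) - 1) := by linarith
    have t2 := mul_le_mul_of_nonneg_right hα0 hfl0
    have t3 := mul_le_mul_of_nonneg_left this hα.le
    linarith
  have hDR : (D : ℝ) / 1000000000 * (C / 1000000000) ≤ (a0 / 1000000000) *
      (C / 1000000000 - (1 - Real.exp (-(C / 1000000000)))) := by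
    have t := mul_le_mul_of_nonneg_left n1 ha0
    linarith
  rcases lt_or_ge (-x (q + 1)) (C / 1000000000) with hmC | hmC
  · refine h.p8 (α0 := a0 / 1000000000) (C := C / 1000000000) (D := D / 1000000000) hq2
      (by linarith) (div_pos ha00 (by norm_num)) (by linarith) hmC hCR hDR (by linarith) ?_
    rw [← sub_div]
    have t := mul_le_mul_of_nonneg_left n2 ha0
    linarith
  · refine h.p9 (α0 := a0 / 1000000000) (C := C / 1000000000) (D := D / 1000000000)
      (mh := m / 1000000000) hq2
      (by linarith) (div_pos ha00 (by norm_num)) (by linarith) hmC hCR hDR (by linarith) hm (by linarith) ?_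
    rw [← sub_div]
    have hE1 : Real.exp (-((D : ℝ) / 1000000000)) ≤ 1 := Real.exp_le_one_iff.2 (by linarith)
    have t1 : 1000000000 * (1 - Real.exp (-((D : ℝ) / 1000000000))) ≤
        ((wS - wnegLo D : ℕ) : ℝ) := by linarith
    have t2 := mul_le_mul n3 t1 (by linarith) (Nat.cast_nonneg _)
    have t3 := mul_le_mul_of_nonneg_left t2 ha0
    linarith

/-! ### The boxes -/

theorem wgroup1 {α q : ℝ} {x : ℝ → ℝ} (h : WFacts α q x)
    (h0 : 2050000000 ≤ 1000000000 * α) (hA : 1000000000 * α ≤ 64 * 32343750) : False := by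
  have hl := h.p4
  have hu := wM_le (a := 32343750) (K := 140872165) h (by exact_mod_cast hA)
    (Nat.le_of_ble_eq_true (by decide +kernel)) (Nat.le_of_ble_eq_true (by decide +kernel))
  have hu' : wHhi 32343750 140872165 64 ≤ 1142500000 := Nat.le_of_ble_eq_true (by decide +kernel)
  have hu2 : 1000000000 * x 1 ≤ (1142500000 : ℕ) := hu.trans (by exact_mod_cast hu')
  have h0' : ((2050000000 : ℕ) : ℝ) ≤ 1000000000 * α := by exact_mod_cast h0
  have hA' : 1000000000 * α ≤ 64 * (32343750 : ℕ) := by exact_mod_cast hA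
  have hm0 : ((1050000000 : ℕ) : ℝ) ≤ 1000000000 * x 1 := by
    push_cast
    linarith
  rcases le_total (1000000000 * x 1) (1068500000 : ℕ) with hm1 | hm1
  · exact wchk_sound h (show wchk 2050000000 32343750 140872165 1050000000 1068500000 48 42 2822740000 1366900000 3245110000 = true by decide +kernel) h0' hA' hm0 hm1
  rcases le_total (1000000000 * x 1) (1087000000 : ℕ) with hn | hm2
  · exact wchk_sound h (show wchk 2050000000 32343750 140872165 1068500000 1087000000 48 42 2913730000 1384600000 3265190000 = true by decide +kernel) h0' hA' hm1 hn
  rcases le_total (1000000000 * x 1) (1105500000 : ℕ) with hn | hm3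
  · exact wchk_sound h (show wchk 2050000000 32343750 140872165 1087000000 1105500000 47 42 3006410000 1401830000 3281170000 = true by decide +kernel) h0' hA' hm2 hn
  rcases le_total (1000000000 * x 1) (1124000000 : ℕ) with hn | hm4
  · exact wchk_sound h (show wchk 2050000000 32343750 140872165 1105500000 1124000000 47 43 3059990000 1411450000 3291270000 = true by decide +kernel) h0' hA' hm3 hn
  exact wchk_sound h (show wchk 2050000000 32343750 140872165 1124000000 1142500000 46 43 3059990000 1411450000 3293960000 = true by decide +kernel) h0' hA' hm4 hu2

theorem wgroup2 {α q : ℝ} {x : ℝ → ℝ} (h : WFacts α q x)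
    (h0 : 2020000000 ≤ 1000000000 * α) (hA : 1000000000 * α ≤ 64 * 32031250) : False := by
  have hl := h.p4
  have hu := wM_le (a := 32031250) (K := 143991909) h (by exact_mod_cast hA)
    (Nat.le_of_ble_eq_true (by decide +kernel)) (Nat.le_of_ble_eq_true (by decide +kernel))
  have hu' : wHhi 32031250 143991909 64 ≤ 1124100000 := Nat.le_of_ble_eq_true (by decide +kernel)
  have hu2 : 1000000000 * x 1 ≤ (1124100000 : ℕ) := hu.trans (by exact_mod_cast hu')
  have h0' : ((2020000000 : ℕ) : ℝ) ≤ 1000000000 * α := by exact_mod_cast h0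
  have hA' : 1000000000 * α ≤ 64 * (32031250 : ℕ) := by exact_mod_cast hA
  have hm0 : ((1020000000 : ℕ) : ℝ) ≤ 1000000000 * x 1 := by
    push_cast
    linarith
  rcases le_total (1000000000 * x 1) (1046020000 : ℕ) with hm1 | hm1
  · exact wchk_sound h (show wchk 2020000000 32031250 143991909 1020000000 1046020000 49 42 2656550000 1312960000 3150190000 = true by decide +kernel) h0' hA' hm0 hm1
  rcases le_total (1000000000 * x 1) (1072050000 : ℕ) with hn | hm2
  · exact wchk_sound h (show wchk 2020000000 32031250 143991909 1046020000 1072050000 48 42 2779830000 1338400000 3178120000 = true by decide +kernel) h0' hA' hm1 hn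
  rcases le_total (1000000000 * x 1) (1098070000 : ℕ) with hn | hm3
  · exact wchk_sound h (show wchk 2020000000 32031250 143991909 1072050000 1098070000 48 43 2979810000 1376520000 3197560000 = true by decide +kernel) h0' hA' hm2 hn
  exact wchk_sound h (show wchk 2020000000 32031250 143991909 1098070000 1124100000 47 43 2989990000 1378360000 3204150000 = true by decide +kernel) h0' hA' hm3 hu2

theorem wgroup3 {α q : ℝ} {x : ℝ → ℝ} (h : WFacts α q x)
    (h0 : 1980000000 ≤ 1000000000 * α) (hA : 1000000000 * α ≤ 64 * 31562500) : False := by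
  have hl := h.p4
  have hu := wM_le (a := 31562500) (K := 148808499) h (by exact_mod_cast hA)
    (Nat.le_of_ble_eq_true (by decide +kernel)) (Nat.le_of_ble_eq_true (by decide +kernel))
  have hu' : wHhi 31562500 148808499 64 ≤ 1096700000 := Nat.le_of_ble_eq_true (by decide +kernel)
  have hu2 : 1000000000 * x 1 ≤ (1096700000 : ℕ) := hu.trans (by exact_mod_cast hu')
  have h0' : ((1980000000 : ℕ) : ℝ) ≤ 1000000000 * α := by exact_mod_cast h0
  have hA' : 1000000000 * α ≤ 64 * (31562500 : ℕ) := by exact_mod_cast hA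
  have hm0 : ((980000000 : ℕ) : ℝ) ≤ 1000000000 * x 1 := by
    push_cast
    linarith
  rcases le_total (1000000000 * x 1) (1018900000 : ℕ) with hm1 | hm1
  · exact wchk_sound h (show wchk 1980000000 31562500 148808499 980000000 1018900000 50 42 2448150000 1241120000 3025190000 = true by decide +kernel) h0' hA' hm0 hm1
  rcases le_total (1000000000 * x 1) (1057800000 : ℕ) with hn | hm2
  · exact wchk_sound h (show wchk 1980000000 31562500 148808499 1018900000 1057800000 49 43 2690450000 1293970000 3064150000 = true by decide +kernel) h0' hA' hm1 hn
  exact wchk_sound h (show wchk 1980000000 31562500 148808499 1057800000 1096700000 48 43 2875710000 1330270000 3079210000 = true by decide +kernel) h0' hA' hm2 hu2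

theorem wgroup4 {α q : ℝ} {x : ℝ → ℝ} (h : WFacts α q x)
    (h0 : 1940000000 ≤ 1000000000 * α) (hA : 1000000000 * α ≤ 64 * 30937500) : False := by
  have hl := h.p4
  have hu := wM_le (a := 30937500) (K := 155495652) h (by exact_mod_cast hA)
    (Nat.le_of_ble_eq_true (by decide +kernel)) (Nat.le_of_ble_eq_true (by decide +kernel))
  have hu' : wHhi 30937500 155495652 64 ≤ 1060400000 := Nat.le_of_ble_eq_true (by decide +kernel)
  have hu2 : 1000000000 * x 1 ≤ (1060400000 : ℕ) := hu.trans (by exact_mod_cast hu')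
  have h0' : ((1940000000 : ℕ) : ℝ) ≤ 1000000000 * α := by exact_mod_cast h0
  have hA' : 1000000000 * α ≤ 64 * (30937500 : ℕ) := by exact_mod_cast hA
  have hm0 : ((940000000 : ℕ) : ℝ) ≤ 1000000000 * x 1 := by
    push_cast
    linarith
  rcases le_total (1000000000 * x 1) (1000200000 : ℕ) with hm1 | hm1
  · exact wchk_sound h (show wchk 1940000000 30937500 155495652 940000000 1000200000 52 42 2258430000 1170750000 2900760000 = true by decide +kernel) h0' hA' hm0 hm1
  exact wchk_sound h (show wchk 1940000000 30937500 155495652 1000200000 1060400000 50 43 2581030000 1245230000 2936190000 = true by decide +kernel) h0' hA' hm1 hu2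

theorem wgroup5 {α q : ℝ} {x : ℝ → ℝ} (h : WFacts α q x)
    (h0 : 1880000000 ≤ 1000000000 * α) (hA : 1000000000 * α ≤ 64 * 30312500) : False := by
  have hl := h.p4
  have hu := wM_le (a := 30312500) (K := 162499318) h (by exact_mod_cast hA)
    (Nat.le_of_ble_eq_true (by decide +kernel)) (Nat.le_of_ble_eq_true (by decide +kernel))
  have hu' : wHhi 30312500 162499318 64 ≤ 1024200000 := Nat.le_of_ble_eq_true (by decide +kernel)
  have hu2 : 1000000000 * x 1 ≤ (1024200000 : ℕ) := hu.trans (by exact_mod_cast hu')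
  have h0' : ((1880000000 : ℕ) : ℝ) ≤ 1000000000 * α := by exact_mod_cast h0
  have hA' : 1000000000 * α ≤ 64 * (30312500 : ℕ) := by exact_mod_cast hA
  have hm0 : ((880000000 : ℕ) : ℝ) ≤ 1000000000 * x 1 := by
    push_cast
    linarith
  rcases le_total (1000000000 * x 1) (952100000 : ℕ) with hm1 | hm1
  · exact wchk_sound h (show wchk 1880000000 30312500 162499318 880000000 952100000 54 42 1978700000 1061210000 2720330000 = true by decide +kernel) h0' hA' hm0 hm1
  exact wchk_sound h (show wchk 1880000000 30312500 162499318 952100000 1024200000 51 44 2376810000 1162440000 2768020000 = true by decide +kernel) h0' hA' hm1 hu2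

theorem wgroup6 {α q : ℝ} {x : ℝ → ℝ} (h : WFacts α q x)
    (h0 : 1800000000 ≤ 1000000000 * α) (hA : 1000000000 * α ≤ 64 * 29375000) : False := by
  have hl := h.p4
  have hu := wM_le (a := 29375000) (K := 173632320) h (by exact_mod_cast hA)
    (Nat.le_of_ble_eq_true (by decide +kernel)) (Nat.le_of_ble_eq_true (by decide +kernel))
  have hu' : wHhi 29375000 173632320 64 ≤ 970300000 := Nat.le_of_ble_eq_true (by decide +kernel)
  have hu2 : 1000000000 * x 1 ≤ (970300000 : ℕ) := hu.trans (by exact_mod_cast hu')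
  have h0' : ((1800000000 : ℕ) : ℝ) ≤ 1000000000 * α := by exact_mod_cast h0
  have hA' : 1000000000 * α ≤ 64 * (29375000 : ℕ) := by exact_mod_cast hA
  have hm0 : ((800000000 : ℕ) : ℝ) ≤ 1000000000 * x 1 := by
    push_cast
    linarith
  rcases le_total (1000000000 * x 1) (885150000 : ℕ) with hm1 | hm1
  · exact wchk_sound h (show wchk 1800000000 29375000 173632320 800000000 885150000 57 42 1645940000 917260000 2456650000 = true by decide +kernel) h0' hA' hm0 hm1
  exact wchk_sound h (show wchk 1800000000 29375000 173632320 885150000 970300000 53 44 2045320000 1033740000 2516890000 = true by decide +kernel) h0' hA' hm1 hu2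

theorem wgroup7 {α q : ℝ} {x : ℝ → ℝ} (h : WFacts α q x)
    (h0 : 1760000000 ≤ 1000000000 * α) (hA : 1000000000 * α ≤ 64 * 28125000) : False := by
  have hl := h.p4
  have hu := wM_le (a := 28125000) (K := 189734307) h (by exact_mod_cast hA)
    (Nat.le_of_ble_eq_true (by decide +kernel)) (Nat.le_of_ble_eq_true (by decide +kernel))
  have hu' : wHhi 28125000 189734307 64 ≤ 899300000 := Nat.le_of_ble_eq_true (by decide +kernel)
  have hu2 : 1000000000 * x 1 ≤ (899300000 : ℕ) := hu.trans (by exact_mod_cast hu')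
  have h0' : ((1760000000 : ℕ) : ℝ) ≤ 1000000000 * α := by exact_mod_cast h0
  have hA' : 1000000000 * α ≤ 64 * (28125000 : ℕ) := by exact_mod_cast hA
  have hm0 : ((760000000 : ℕ) : ℝ) ≤ 1000000000 * x 1 := by
    push_cast
    linarith
  exact wchk_sound h (show wchk 1760000000 28125000 189734307 760000000 899300000 59 44 1595460000 880580000 2339110000 = true by decide +kernel) h0' hA' hm0 hu2

theorem wgroup8 {α q : ℝ} {x : ℝ → ℝ} (h : WFacts α q x)
    (h0 : 1720000000 ≤ 1000000000 * α) (hA : 1000000000 * α ≤ 64 * 27500000) : False := by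
  have hl := h.p4
  have hu := wM_le (a := 27500000) (K := 198363750) h (by exact_mod_cast hA)
    (Nat.le_of_ble_eq_true (by decide +kernel)) (Nat.le_of_ble_eq_true (by decide +kernel))
  have hu' : wHhi 27500000 198363750 64 ≤ 864100000 := Nat.le_of_ble_eq_true (by decide +kernel)
  have hu2 : 1000000000 * x 1 ≤ (864100000 : ℕ) := hu.trans (by exact_mod_cast hu')
  have h0' : ((1720000000 : ℕ) : ℝ) ≤ 1000000000 * α := by exact_mod_cast h0
  have hA' : 1000000000 * α ≤ 64 * (27500000 : ℕ) := by exact_mod_cast hA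
  have hm0 : ((720000000 : ℕ) : ℝ) ≤ 1000000000 * x 1 := by
    push_cast
    linarith
  exact wchk_sound h (show wchk 1720000000 27500000 198363750 720000000 864100000 61 44 1448070000 811350000 2187360000 = true by decide +kernel) h0' hA' hm0 hu2

theorem wgroup9 {α q : ℝ} {x : ℝ → ℝ} (h : WFacts α q x)
    (h0 : 1690000000 ≤ 1000000000 * α) (hA : 1000000000 * α ≤ 64 * 26875000) : False := by
  have hl := h.p4
  have hu := wM_le (a := 26875000) (K := 207403386) h (by exact_mod_cast hA)
    (Nat.le_of_ble_eq_true (by decide +kernel)) (Nat.le_of_ble_eq_true (by decide +kernel))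
  have hu' : wHhi 26875000 207403386 64 ≤ 829200000 := Nat.le_of_ble_eq_true (by decide +kernel)
  have hu2 : 1000000000 * x 1 ≤ (829200000 : ℕ) := hu.trans (by exact_mod_cast hu')
  have h0' : ((1690000000 : ℕ) : ℝ) ≤ 1000000000 * α := by exact_mod_cast h0
  have hA' : 1000000000 * α ≤ 64 * (26875000 : ℕ) := by exact_mod_cast hA
  have hm0 : ((690000000 : ℕ) : ℝ) ≤ 1000000000 * x 1 := by
    push_cast
    linarith
  exact wchk_sound h (show wchk 1690000000 26875000 207403386 690000000 829200000 62 45 1376580000 772210000 2013400000 = true by decide +kernel) h0' hA' hm0 hu2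

theorem wgroup10 {α q : ℝ} {x : ℝ → ℝ} (h : WFacts α q x)
    (h0 : 1640000000 ≤ 1000000000 * α) (hA : 1000000000 * α ≤ 64 * 26406250) : False := by
  have hl := h.p4
  have hu := wM_le (a := 26406250) (K := 214463901) h (by exact_mod_cast hA)
    (Nat.le_of_ble_eq_true (by decide +kernel)) (Nat.le_of_ble_eq_true (by decide +kernel))
  have hu' : wHhi 26406250 214463901 64 ≤ 803300000 := Nat.le_of_ble_eq_true (by decide +kernel)
  have hu2 : 1000000000 * x 1 ≤ (803300000 : ℕ) := hu.trans (by exact_mod_cast hu')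
  have h0' : ((1640000000 : ℕ) : ℝ) ≤ 1000000000 * α := by exact_mod_cast h0
  have hA' : 1000000000 * α ≤ 64 * (26406250 : ℕ) := by exact_mod_cast hA
  have hm0 : ((640000000 : ℕ) : ℝ) ≤ 1000000000 * x 1 := by
    push_cast
    linarith
  rcases le_total (1000000000 * x 1) (721650000 : ℕ) with hm1 | hm1
  · exact wchk_sound h (show wchk 1640000000 26406250 214463901 640000000 721650000 62 45 1201060000 685350000 1680920000 = true by decide +kernel) h0' hA' hm0 hm1
  exact wchk_sound h (show wchk 1640000000 26406250 214463901 721650000 803300000 58 48 1521890000 797610000 1721710000 = true by decide +kernel) h0' hA' hm1 hu2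

theorem wgroup11 {α q : ℝ} {x : ℝ → ℝ} (h : WFacts α q x)
    (h0 : 1590000000 ≤ 1000000000 * α) (hA : 1000000000 * α ≤ 64 * 25625000) : False := by
  have hl := h.p4
  have hu := wM_le (a := 25625000) (K := 226791077) h (by exact_mod_cast hA)
    (Nat.le_of_ble_eq_true (by decide +kernel)) (Nat.le_of_ble_eq_true (by decide +kernel))
  have hu' : wHhi 25625000 226791077 64 ≤ 760400000 := Nat.le_of_ble_eq_true (by decide +kernel)
  have hu2 : 1000000000 * x 1 ≤ (760400000 : ℕ) := hu.trans (by exact_mod_cast hu')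
  have h0' : ((1590000000 : ℕ) : ℝ) ≤ 1000000000 * α := by exact_mod_cast h0
  have hA' : 1000000000 * α ≤ 64 * (25625000 : ℕ) := by exact_mod_cast hA
  have hm0 : ((590000000 : ℕ) : ℝ) ≤ 1000000000 * x 1 := by
    push_cast
    linarith
  rcases le_total (1000000000 * x 1) (624080000 : ℕ) with hm1 | hm1
  · exact wchk_sound h (show wchk 1590000000 25625000 226791077 590000000 624080000 62 45 1045730000 603860000 1330940000 = true by decide +kernel) h0' hA' hm0 hm1
  rcases le_total (1000000000 * x 1) (658160000 : ℕ) with hn | hm2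
  · exact wchk_sound h (show wchk 1590000000 25625000 226791077 624080000 658160000 61 47 1181720000 657220000 1365430000 = true by decide +kernel) h0' hA' hm1 hn
  rcases le_total (1000000000 * x 1) (692240000 : ℕ) with hn | hm3
  · exact wchk_sound h (show wchk 1590000000 25625000 226791077 658160000 692240000 59 48 1299460000 700040000 1392210000 = true by decide +kernel) h0' hA' hm2 hn
  rcases le_total (1000000000 * x 1) (726320000 : ℕ) with hn | hm4
  · exact wchk_sound h (show wchk 1590000000 25625000 226791077 692240000 726320000 58 49 1420990000 741240000 1409360000 = true by decide +kernel) h0' hA' hm3 hn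
  exact wchk_sound h (show wchk 1590000000 25625000 226791077 726320000 760400000 56 50 1546340000 780790000 1412320000 = true by decide +kernel) h0' hA' hm4 hu2

theorem wgroup12 {α q : ℝ} {x : ℝ → ℝ} (h : WFacts α q x)
    (h0 : 1575000000 ≤ 1000000000 * α) (hA : 1000000000 * α ≤ 64 * 24843750) : False := by
  have hl := h.p4
  have hu := wM_le (a := 24843750) (K := 239852696) h (by exact_mod_cast hA)
    (Nat.le_of_ble_eq_true (by decide +kernel)) (Nat.le_of_ble_eq_true (by decide +kernel))
  have hu' : wHhi 24843750 239852696 64 ≤ 718000000 := Nat.le_of_ble_eq_true (by decide +kernel)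
  have hu2 : 1000000000 * x 1 ≤ (718000000 : ℕ) := hu.trans (by exact_mod_cast hu')
  have h0' : ((1575000000 : ℕ) : ℝ) ≤ 1000000000 * α := by exact_mod_cast h0
  have hA' : 1000000000 * α ≤ 64 * (24843750 : ℕ) := by exact_mod_cast hA
  have hm0 : ((575000000 : ℕ) : ℝ) ≤ 1000000000 * x 1 := by
    push_cast
    linarith
  rcases le_total (1000000000 * x 1) (622660000 : ℕ) with hm1 | hm1
  · exact wchk_sound h (show wchk 1575000000 24843750 239852696 575000000 622660000 63 47 1051450000 600470000 1257790000 = true by decide +kernel) h0' hA' hm0 hm1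
  rcases le_total (1000000000 * x 1) (670330000 : ℕ) with hn | hm2
  · exact wchk_sound h (show wchk 1575000000 24843750 239852696 622660000 670330000 61 49 1217570000 664250000 1289340000 = true by decide +kernel) h0' hA' hm1 hn
  exact wchk_sound h (show wchk 1575000000 24843750 239852696 670330000 718000000 59 51 1389630000 723990000 1297700000 = true by decide +kernel) h0' hA' hm2 hu2

theorem wgroup13 {α q : ℝ} {x : ℝ → ℝ} (h : WFacts α q x)
    (h0 : 1570700000 ≤ 1000000000 * α) (hA : 1000000000 * α ≤ 64 * 24609375) : False := by
  have hl := h.p4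
  have hu := wM_le (a := 24609375) (K := 243920578) h (by exact_mod_cast hA)
    (Nat.le_of_ble_eq_true (by decide +kernel)) (Nat.le_of_ble_eq_true (by decide +kernel))
  have hu' : wHhi 24609375 243920578 64 ≤ 705400000 := Nat.le_of_ble_eq_true (by decide +kernel)
  have hu2 : 1000000000 * x 1 ≤ (705400000 : ℕ) := hu.trans (by exact_mod_cast hu')
  have h0' : ((1570700000 : ℕ) : ℝ) ≤ 1000000000 * α := by exact_mod_cast h0
  have hA' : 1000000000 * α ≤ 64 * (24609375 : ℕ) := by exact_mod_cast hA
  have hm0 : ((570700000 : ℕ) : ℝ) ≤ 1000000000 * x 1 := by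
    push_cast
    linarith
  rcases le_total (1000000000 * x 1) (615600000 : ℕ) with hm1 | hm1
  · exact wchk_sound h (show wchk 1570700000 24609375 243920578 570700000 615600000 63 48 1058990000 601860000 1212250000 = true by decide +kernel) h0' hA' hm0 hm1
  rcases le_total (1000000000 * x 1) (660500000 : ℕ) with hn | hm2
  · exact wchk_sound h (show wchk 1570700000 24609375 243920578 615600000 660500000 61 49 1197700000 655160000 1239830000 = true by decide +kernel) h0' hA' hm1 hn
  exact wchk_sound h (show wchk 1570700000 24609375 243920578 660500000 705400000 59 51 1359390000 711970000 1246300000 = true by decide +kernel) h0' hA' hm2 hu2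

theorem qbar_lt_three (α q qbar : ℝ) (x : ℝ → ℝ)
    (hα : α ∈ Set.Icc (Real.pi / 2) 2.07)
    (hx : SOPSX α q qbar x) :
    qbar < 3 := by
  by_contra hq3
  have hpi := Real.pi_gt_d6
  obtain ⟨h1, h2⟩ := hα
  have h1' : 1570700000 ≤ 1000000000 * α := by linarith
  have h2' : 1000000000 * α ≤ 2070000000 := by
    norm_num at h2
    linarith
  have h := wfacts_of (by linarith) hx (not_lt.1 hq3)
  rcases le_total 2050000000 (1000000000 * α) with hc | h2'
  · exact wgroup1 h hc (by linarith)
  rcases le_total 2020000000 (1000000000 * α) with hc | h2'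
  · exact wgroup2 h hc (by linarith)
  rcases le_total 1980000000 (1000000000 * α) with hc | h2'
  · exact wgroup3 h hc (by linarith)
  rcases le_total 1940000000 (1000000000 * α) with hc | h2'
  · exact wgroup4 h hc (by linarith)
  rcases le_total 1880000000 (1000000000 * α) with hc | h2'
  · exact wgroup5 h hc (by linarith)
  rcases le_total 1800000000 (1000000000 * α) with hc | h2'
  · exact wgroup6 h hc (by linarith)
  rcases le_total 1760000000 (1000000000 * α) with hc | h2'
  · exact wgroup7 h hc (by linarith)
  rcases le_total 1720000000 (1000000000 * α) with hc | h2'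
  · exact wgroup8 h hc (by linarith)
  rcases le_total 1690000000 (1000000000 * α) with hc | h2'
  · exact wgroup9 h hc (by linarith)
  rcases le_total 1640000000 (1000000000 * α) with hc | h2'
  · exact wgroup10 h hc (by linarith)
  rcases le_total 1590000000 (1000000000 * α) with hc | h2'
  · exact wgroup11 h hc (by linarith)
  rcases le_total 1575000000 (1000000000 * α) with hc | h2'
  · exact wgroup12 h hc (by linarith)
  exact wgroup13 h h1' (by linarith)
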